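/- Completeness: if a sequent φ ⊢ ψ of the modal language L is not derivable in the basic logic L, then there exists a graph-based L-frame F (and a graph-based model M based on F with a state z such that M,z ⊩ φ, M,z ≻ ψ, and z E z) in which φ ⊢ ψ is not valid. Hence the basic logic L is complete with respect to the class of graph-based L-frames. -/

import Mathlib

/-- `T^{[1]}[U] = {v ∈ Z | ∀ u ∈ U, ¬ (u T v)}`. -/
def rOne {Z : Type*} (T : Z → Z → Prop) (U : Set Z) : Set Z := {v | ∀ u ∈ U, ¬ T u v}

/-- `T^{[0]}[V] = {u ∈ Z | ∀ v ∈ V, ¬ (u T v)}`. -/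
def rZero {Z : Type*} (T : Z → Z → Prop) (V : Set Z) : Set Z := {u | ∀ v ∈ V, ¬ T u v}

/-- `R` is `E`-compatible: for all `b, y`,
`(R^{[0]}[{y}])^{[10]} ⊆ R^{[0]}[{y}]` and `(R^{[1]}[{b}])^{[01]} ⊆ R^{[1]}[{b}]`. -/
def ECompat {Z : Type*} (E R : Z → Z → Prop) : Prop :=
  (∀ y : Z, rZero E (rOne E (rZero R {y})) ⊆ rZero R {y}) ∧
  (∀ b : Z, rOne E (rZero E (rOne R {b})) ⊆ rOne R {b})

/-- A concept of the graph `(Z,E)`: a pair `(B,Y)` with `Y = B^{[1]}` and `B = Y^{[0]}`. -/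
def isConcept {Z : Type*} (E : Z → Z → Prop) (c : Set Z × Set Z) : Prop :=
  c.2 = rOne E c.1 ∧ c.1 = rZero E c.2

/-- `[R](B,Y) = (R^{[0]}[Y], (R^{[0]}[Y])^{[1]})`. -/
def boxMap {Z : Type*} (E R : Z → Z → Prop) (c : Set Z × Set Z) : Set Z × Set Z :=
  (rZero R c.2, rOne E (rZero R c.2))

/-- `⟨R⟩(B,Y) = ((R^{[0]}[B])^{[0]}, R^{[0]}[B])`. -/
def diaMap {Z : Type*} (E R : Z → Z → Prop) (c : Set Z × Set Z) : Set Z × Set Z :=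
  (rZero E (rZero R c.1), rZero R c.1)

/-- Formulas of the basic normal non-distributive modal language `L`. -/
inductive Fm : Type
  | bot : Fm
  | top : Fm
  | var : ℕ → Fm
  | conj : Fm → Fm → Fm
  | disj : Fm → Fm → Fm
  | box : Fm → Fm
  | dia : Fm → Fm

/-- Satisfaction (`.1`) and co-satisfaction/refutation (`.2`) at states, defined by
simultaneous recursion on the formula. -/
def sat {Z : Type*} (E Rb Rd : Z → Z → Prop) (V : ℕ → Set Z × Set Z) :
    Fm → (Z → Prop) × (Z → Prop)
  | .bot => (fun _ => False, fun _ => True)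
  | .top => (fun _ => True, fun _ => False)
  | .var n => (fun z => z ∈ (V n).1, fun z => ∀ z', E z' z → z' ∉ (V n).1)
  | .conj φ ψ =>
      (fun z => (sat E Rb Rd V φ).1 z ∧ (sat E Rb Rd V ψ).1 z,
       fun z => ∀ z', E z' z → ¬ ((sat E Rb Rd V φ).1 z' ∧ (sat E Rb Rd V ψ).1 z'))
  | .disj φ ψ =>
      (fun z => ∀ z', E z z' → ¬ ((sat E Rb Rd V φ).2 z' ∧ (sat E Rb Rd V ψ).2 z'),
       fun z => (sat E Rb Rd V φ).2 z ∧ (sat E Rb Rd V ψ).2 z)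
  | .box φ =>
      (fun z => ∀ z', Rb z z' → ¬ (sat E Rb Rd V φ).2 z',
       fun z => ∀ z', E z' z → ¬ (∀ z'', Rb z' z'' → ¬ (sat E Rb Rd V φ).2 z''))
  | .dia φ =>
      (fun z => ∀ z', E z z' → ¬ (∀ z'', Rd z' z'' → ¬ (sat E Rb Rd V φ).1 z''),
       fun z => ∀ z', Rd z z' → ¬ (sat E Rb Rd V φ).1 z')

/-- A graph-based `L`-frame: a reflexive graph `(Z,E)` with `E`-compatible `R_□`, `R_◇`. -/
structure GFrame (Z : Type*) where
  E : Z → Z → Prop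
  Rb : Z → Z → Prop
  Rd : Z → Z → Prop
  nonempty : Nonempty Z
  refl : ∀ z : Z, E z z
  compatB : ECompat E Rb
  compatD : ECompat E Rd

/-- The sequent `φ ⊢ ψ` is true in the model `(F, V)`. -/
def trueIn {Z : Type*} (F : GFrame Z) (V : ℕ → Set Z × Set Z) (φ ψ : Fm) : Prop :=
  ∀ z z' : Z, (sat F.E F.Rb F.Rd V φ).1 z → (sat F.E F.Rb F.Rd V ψ).2 z' → ¬ F.E z z'

/-- The sequent `φ ⊢ ψ` is valid in the frame `F`: true in every model based on `F`,
i.e. for every valuation sending proposition letters to concepts. -/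
def validIn {Z : Type*} (F : GFrame Z) (φ ψ : Fm) : Prop :=
  ∀ V : ℕ → Set Z × Set Z, (∀ n, isConcept F.E (V n)) → trueIn F V φ ψ

/-- Substitution of `χ` for the variable `p`: `φ(χ/p)`. -/
def sub1 (p : ℕ) (χ : Fm) : Fm → Fm
  | .bot => .bot
  | .top => .top
  | .var n => if n = p then χ else .var n
  | .conj φ ψ => .conj (sub1 p χ φ) (sub1 p χ ψ)
  | .disj φ ψ => .disj (sub1 p χ φ) (sub1 p χ ψ)
  | .box φ => .box (sub1 p χ φ)
  | .dia φ => .dia (sub1 p χ φ)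

/-- Derivability of sequents in the basic logic `L`. -/
inductive Deriv : Fm → Fm → Prop
  | axId : Deriv (.var 0) (.var 0)
  | axBot : Deriv .bot (.var 0)
  | axTop : Deriv (.var 0) .top
  | axOr1 : Deriv (.var 0) (.disj (.var 0) (.var 1))
  | axOr2 : Deriv (.var 1) (.disj (.var 0) (.var 1))
  | axAnd1 : Deriv (.conj (.var 0) (.var 1)) (.var 0)
  | axAnd2 : Deriv (.conj (.var 0) (.var 1)) (.var 1)
  | axBoxTop : Deriv .top (.box .top)
  | axBoxAnd : Deriv (.conj (.box (.var 0)) (.box (.var 1))) (.box (.conj (.var 0) (.var 1)))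
  | axDiaBot : Deriv (.dia .bot) .bot
  | axDiaOr : Deriv (.disj (.dia (.var 0)) (.dia (.var 1))) (.dia (.disj (.var 0) (.var 1)))
  | cut {φ χ ψ : Fm} : Deriv φ χ → Deriv χ ψ → Deriv φ ψ
  | subst (p : ℕ) (χ : Fm) {φ ψ : Fm} : Deriv φ ψ → Deriv (sub1 p χ φ) (sub1 p χ ψ)
  | andIntro {χ φ ψ : Fm} : Deriv χ φ → Deriv χ ψ → Deriv χ (.conj φ ψ)
  | orElim {φ ψ χ : Fm} : Deriv φ χ → Deriv ψ χ → Deriv (.disj φ ψ) χ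
  | monoBox {φ ψ : Fm} : Deriv φ ψ → Deriv (.box φ) (.box ψ)
  | monoDia {φ ψ : Fm} : Deriv φ ψ → Deriv (.dia φ) (.dia ψ)

/-- A strict bound on the variables of a formula. -/
def fvb : Fm → ℕ
  | .bot => 0
  | .top => 0
  | .var n => n + 1
  | .conj φ ψ => max (fvb φ) (fvb ψ)
  | .disj φ ψ => max (fvb φ) (fvb ψ)
  | .box φ => fvb φ
  | .dia φ => fvb φ

theorem sub1_fresh (k : ℕ) (χ : Fm) : ∀ φ : Fm, fvb φ ≤ k → sub1 k χ φ = φ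
  | .bot, _ => rfl
  | .top, _ => rfl
  | .var n, h => by
      have : n ≠ k := by simp only [fvb] at h; omega
      simp [sub1, this]
  | .conj φ ψ, h => by
      simp only [fvb, max_le_iff] at h
      simp [sub1, sub1_fresh k χ φ h.1, sub1_fresh k χ ψ h.2]
  | .disj φ ψ, h => by
      simp only [fvb, max_le_iff] at h
      simp [sub1, sub1_fresh k χ φ h.1, sub1_fresh k χ ψ h.2]
  | .box φ, h => by
      simp only [fvb] at h
      simp [sub1, sub1_fresh k χ φ h]
  | .dia φ, h => by
      simp only [fvb] at h
      simp [sub1, sub1_fresh k χ φ h]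

theorem dId (φ : Fm) : Deriv φ φ := by
  simpa [sub1] using Deriv.subst 0 φ Deriv.axId

theorem dBot (φ : Fm) : Deriv .bot φ := by
  simpa [sub1] using Deriv.subst 0 φ Deriv.axBot

theorem dTop (φ : Fm) : Deriv φ .top := by
  simpa [sub1] using Deriv.subst 0 φ Deriv.axTop

theorem dOr1 (φ ψ : Fm) : Deriv φ (.disj φ ψ) := by
  have h := Deriv.subst (fvb φ + 1) ψ
    (Deriv.subst 0 φ (Deriv.subst 1 (.var (fvb φ + 1)) Deriv.axOr1))
  simpa [sub1, sub1_fresh (fvb φ + 1) ψ φ (by omega)] using h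

theorem dOr2 (φ ψ : Fm) : Deriv ψ (.disj φ ψ) := by
  have h := Deriv.subst (fvb φ + 1) ψ
    (Deriv.subst 0 φ (Deriv.subst 1 (.var (fvb φ + 1)) Deriv.axOr2))
  simpa [sub1, sub1_fresh (fvb φ + 1) ψ φ (by omega)] using h

theorem dAnd1 (φ ψ : Fm) : Deriv (.conj φ ψ) φ := by
  have h := Deriv.subst (fvb φ + 1) ψ
    (Deriv.subst 0 φ (Deriv.subst 1 (.var (fvb φ + 1)) Deriv.axAnd1))
  simpa [sub1, sub1_fresh (fvb φ + 1) ψ φ (by omega)] using h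

theorem dAnd2 (φ ψ : Fm) : Deriv (.conj φ ψ) ψ := by
  have h := Deriv.subst (fvb φ + 1) ψ
    (Deriv.subst 0 φ (Deriv.subst 1 (.var (fvb φ + 1)) Deriv.axAnd2))
  simpa [sub1, sub1_fresh (fvb φ + 1) ψ φ (by omega)] using h

theorem dBoxAnd (φ ψ : Fm) : Deriv (.conj (.box φ) (.box ψ)) (.box (.conj φ ψ)) := by
  have h := Deriv.subst (fvb φ + 1) ψ
    (Deriv.subst 0 φ (Deriv.subst 1 (.var (fvb φ + 1)) Deriv.axBoxAnd))
  simpa [sub1, sub1_fresh (fvb φ + 1) ψ φ (by omega)] using h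

/-- Proper filters of formulas. -/
structure Fil where
  c : Set Fm
  up : ∀ {a b}, a ∈ c → Deriv a b → b ∈ c
  conj : ∀ {a b}, a ∈ c → b ∈ c → Fm.conj a b ∈ c
  top : Fm.top ∈ c
  bot : Fm.bot ∉ c

/-- Proper ideals of formulas. -/
structure Idl where
  c : Set Fm
  dn : ∀ {a b}, b ∈ c → Deriv a b → a ∈ c
  disj : ∀ {a b}, a ∈ c → b ∈ c → Fm.disj a b ∈ c
  bot : Fm.bot ∈ c
  top : Fm.top ∉ c

/-- Principal filter. -/
def pFil (χ : Fm) (h : ¬ Deriv χ .bot) : Fil where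
  c := {a | Deriv χ a}
  up := fun h1 h2 => Deriv.cut h1 h2
  conj := fun h1 h2 => Deriv.andIntro h1 h2
  top := dTop _
  bot := h

/-- Principal ideal. -/
def pIdl (χ : Fm) (h : ¬ Deriv .top χ) : Idl where
  c := {a | Deriv a χ}
  dn := fun h1 h2 => Deriv.cut h2 h1
  disj := fun h1 h2 => Deriv.orElim h1 h2
  bot := dBot _
  top := h

/-- States. `A`, `B` are canonical witnesses for satisfaction and refutation; `V`, `D`
make the diamond relation compatible; `C` is a general state. -/
inductive St : Type
  | A (F : Fil)
  | B (J : Idl)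
  | V (J : Idl)
  | D (F : Fil)
  | C (F : Fil) (J : Idl) (h : ∀ a ∈ F.c, a ∉ J.c)

/-- Satisfied formulas. -/
def sF : St → Set Fm
  | .A F => F.c
  | .B _ => {a | Deriv .top a}
  | .V _ => {a | Deriv .top a}
  | .D F => F.c
  | .C F _ _ => F.c

/-- Refuted formulas. -/
def sJ : St → Set Fm
  | .A _ => {a | Deriv a .bot}
  | .B J => J.c
  | .V _ => {a | Deriv a .bot}
  | .D _ => {a | Deriv a .bot}
  | .C _ J _ => J.c

/-- Which pairs of distinct states are allowed to be connected. -/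
inductive Link : St → St → Prop
  | a (F : Fil) (z : St) : Link (.A F) z
  | b (z : St) (J : Idl) : Link z (.B J)
  | v (z : St) (J : Idl) : sJ z ⊆ J.c → Link z (.V J)
  | d (F : Fil) (z : St) : sF z ⊆ F.c → Link (.D F) z
  | r (z : St) : Link z z

/-- The graph. -/
def cE (z z' : St) : Prop := (∀ a ∈ sF z, a ∉ sJ z') ∧ Link z z'

/-- The box relation. -/
def cB (z z' : St) : Prop := ∀ a, Fm.box a ∈ sF z → a ∉ sJ z'

/-- The diamond relation. -/
def cD (z z' : St) : Prop := ∀ a ∈ sF z', Fm.dia a ∉ sJ z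

theorem exFil (hc : ¬ Deriv .top .bot) (z : St) : ∃ F : Fil, F.c = sF z := by
  cases z with
  | A F => exact ⟨F, rfl⟩
  | B J => exact ⟨pFil .top hc, rfl⟩
  | V J => exact ⟨pFil .top hc, rfl⟩
  | D F => exact ⟨F, rfl⟩
  | C F J h => exact ⟨F, rfl⟩

theorem exIdl (hc : ¬ Deriv .top .bot) (z : St) : ∃ J : Idl, J.c = sJ z := by
  cases z with
  | A F => exact ⟨pIdl .bot hc, rfl⟩
  | B J => exact ⟨J, rfl⟩
  | V J => exact ⟨pIdl .bot hc, rfl⟩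
  | D F => exact ⟨pIdl .bot hc, rfl⟩
  | C F J h => exact ⟨J, rfl⟩

theorem cDisj (hc : ¬ Deriv .top .bot) (z : St) : ∀ a ∈ sF z, a ∉ sJ z := by
  cases z with
  | A F => exact fun a h1 h2 => F.bot (F.up h1 h2)
  | B J => exact fun a h1 h2 => J.top (J.dn h2 h1)
  | V J => exact fun a h1 h2 => hc (Deriv.cut h1 h2)
  | D F => exact fun a h1 h2 => F.bot (F.up h1 h2)
  | C F J h => exact h

theorem cRefl (hc : ¬ Deriv .top .bot) (z : St) : cE z z := ⟨cDisj hc z, .r z⟩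

/-- Sufficient neighbourhood condition for compatibility. -/
theorem compat_of {Z : Type*} (E R : Z → Z → Prop)
    (h1 : ∀ z u, R z u → ∃ v, E z v ∧ ∀ z', E z' v → R z' u)
    (h2 : ∀ z u, R z u → ∃ w, E w u ∧ ∀ u', E w u' → R z u') : ECompat E R := by
  constructor
  · intro y z hz v hv hR
    obtain rfl : v = y := hv
    obtain ⟨w, hw, hw'⟩ := h1 z v hR
    exact hz w (fun u hu hE => hu v rfl (hw' u hE)) hw
  · intro b y hy v hv hR
    obtain rfl : v = b := hv
    obtain ⟨w, hw, hw'⟩ := h2 v y hR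
    exact hy w (fun u hu hE => hu v rfl (hw' u hE)) hw

theorem link_V {z : St} {J : Idl} (h : Link z (.V J)) : sJ z ⊆ J.c := by
  cases h with
  | a F => exact fun a ha => J.dn J.bot ha
  | v _ _ h => exact h
  | d F _ h => exact fun a ha => J.dn J.bot ha
  | r => exact fun a ha => J.dn J.bot ha

theorem link_D {z : St} {F : Fil} (h : Link (.D F) z) : sF z ⊆ F.c := by
  cases h with
  | b _ J => exact fun a ha => F.up F.top ha
  | v _ J h => exact fun a ha => F.up F.top ha
  | d _ _ h => exact h
  | r => exact fun a ha => ha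

theorem compatD (hc : ¬ Deriv .top .bot) : ECompat cE cD := by
  apply compat_of
  · intro z u h
    obtain ⟨J, hJ⟩ := exIdl hc z
    obtain ⟨F, hF⟩ := exFil hc z
    refine ⟨.V J, ⟨fun a h1 h2 => ?_, .v _ _ hJ.ge⟩, fun z' h' a ha hj => h a ha ?_⟩
    · rw [← hF] at h1
      exact F.bot (F.up h1 h2)
    · rw [← hJ]
      exact link_V h'.2 hj
  · intro z u h
    obtain ⟨F, hF⟩ := exFil hc u
    refine ⟨.D F, ⟨?_, .d _ _ hF.ge⟩, fun u' h' a ha => h a ?_⟩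
    · intro a ha
      exact cDisj hc u a (hF ▸ ha)
    · rw [← hF]
      exact link_D h'.2 ha

theorem compatB (hc : ¬ Deriv .top .bot) : ECompat cE cB := by
  apply compat_of
  · intro z u h
    obtain ⟨J, hJ⟩ := exIdl hc u
    obtain ⟨F, hF⟩ := exFil hc z
    rw [cB, ← hF, ← hJ] at h
    let K : Idl :=
      { c := {x | ∃ a ∈ J.c, Deriv x (.box a)}
        dn := fun ⟨a, h1, h2⟩ h3 => ⟨a, h1, .cut h3 h2⟩
        disj := fun ⟨a, h1, h2⟩ ⟨b, h3, h4⟩ => ⟨.disj a b, J.disj h1 h3,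
          .orElim (.cut h2 (.monoBox (dOr1 _ _))) (.cut h4 (.monoBox (dOr2 _ _)))⟩
        bot := ⟨.bot, J.bot, dBot _⟩
        top := fun ⟨a, h1, h2⟩ => h a (F.up F.top h2) h1 }
    refine ⟨.B K, ⟨?_, .b _ _⟩, ?_⟩
    · rintro x hx ⟨a, h1, h2⟩
      rw [← hF] at hx
      exact h a (F.up hx h2) h1
    · intro z' h' a ha hj
      rw [← hJ] at hj
      exact h'.1 _ ha ⟨a, hj, dId _⟩
  · intro z u h
    obtain ⟨J, hJ⟩ := exIdl hc u
    obtain ⟨F, hF⟩ := exFil hc z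
    rw [cB, ← hF, ← hJ] at h
    let K : Fil :=
      { c := {x | Fm.box x ∈ F.c}
        up := fun h1 h2 => F.up h1 (.monoBox h2)
        conj := fun h1 h2 => F.up (F.conj h1 h2) (dBoxAnd _ _)
        top := F.up F.top .axBoxTop
        bot := fun h1 => h _ h1 J.bot }
    refine ⟨.A K, ⟨?_, .a _ _⟩, ?_⟩
    · intro x hx
      rw [← hJ]
      exact h x hx
    · intro u' h' a ha
      rw [← hF] at ha
      exact h'.1 a ha

theorem memF (hc : ¬ Deriv .top .bot) (z : St) (χ : Fm) :
    χ ∈ sF z ↔ ∀ z', cE z z' → χ ∉ sJ z' := by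
  refine ⟨fun h z' hE => hE.1 _ h, fun h => ?_⟩
  by_contra hn
  obtain ⟨F, hF⟩ := exFil hc z
  rw [← hF] at hn
  refine h (.B (pIdl χ fun h1 => hn (F.up F.top h1))) ⟨?_, .b _ _⟩ (dId χ)
  intro a ha h2
  rw [← hF] at ha
  exact hn (F.up ha h2)

theorem memJ (hc : ¬ Deriv .top .bot) (z : St) (χ : Fm) :
    χ ∈ sJ z ↔ ∀ z', cE z' z → χ ∉ sF z' := by
  refine ⟨fun h z' hE h' => hE.1 _ h' h, fun h => ?_⟩
  by_contra hn
  obtain ⟨J, hJ⟩ := exIdl hc z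
  rw [← hJ] at hn
  refine h (.A (pFil χ fun h1 => hn (J.dn J.bot h1))) ⟨?_, .a _ _⟩ (dId χ)
  intro a ha h2
  rw [← hJ] at h2
  exact hn (J.dn h2 ha)

theorem memBox (hc : ¬ Deriv .top .bot) (z : St) (χ : Fm) :
    Fm.box χ ∈ sF z ↔ ∀ z', cB z z' → χ ∉ sJ z' := by
  refine ⟨fun h z' hE => hE _ h, fun h => ?_⟩
  by_contra hn
  obtain ⟨F, hF⟩ := exFil hc z
  rw [← hF] at hn
  refine h (.B (pIdl χ fun h1 => hn (F.up (F.up F.top .axBoxTop) (.monoBox h1)))) ?_ (dId χ)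
  intro a ha h2
  rw [← hF] at ha
  exact hn (F.up ha (.monoBox h2))

theorem memDia (hc : ¬ Deriv .top .bot) (z : St) (χ : Fm) :
    Fm.dia χ ∈ sJ z ↔ ∀ z', cD z z' → χ ∉ sF z' := by
  refine ⟨fun h z' hE h' => hE _ h' h, fun h => ?_⟩
  by_contra hn
  obtain ⟨J, hJ⟩ := exIdl hc z
  rw [← hJ] at hn
  refine h (.A (pFil χ fun h1 => hn (J.dn J.bot (.cut (.monoDia h1) .axDiaBot)))) ?_ (dId χ)
  intro a ha h2
  rw [← hJ] at h2
  exact hn (J.dn h2 (.monoDia ha))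

/-- The canonical valuation. -/
def cV (n : ℕ) : Set St × Set St := ({z | Fm.var n ∈ sF z}, {z | Fm.var n ∈ sJ z})

theorem truth (hc : ¬ Deriv .top .bot) (χ : Fm) : ∀ z,
    ((sat cE cB cD cV χ).1 z ↔ χ ∈ sF z) ∧ ((sat cE cB cD cV χ).2 z ↔ χ ∈ sJ z) := by
  have hconj : ∀ (z : St) (a b : Fm), Fm.conj a b ∈ sF z ↔ a ∈ sF z ∧ b ∈ sF z := by
    intro z a b
    obtain ⟨F, hF⟩ := exFil hc z
    rw [← hF]
    exact ⟨fun h => ⟨F.up h (dAnd1 _ _), F.up h (dAnd2 _ _)⟩, fun h => F.conj h.1 h.2⟩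
  have hdisj : ∀ (z : St) (a b : Fm), Fm.disj a b ∈ sJ z ↔ a ∈ sJ z ∧ b ∈ sJ z := by
    intro z a b
    obtain ⟨J, hJ⟩ := exIdl hc z
    rw [← hJ]
    exact ⟨fun h => ⟨J.dn h (dOr1 _ _), J.dn h (dOr2 _ _)⟩, fun h => J.disj h.1 h.2⟩
  induction χ with
  | bot =>
    intro z
    obtain ⟨F, hF⟩ := exFil hc z
    obtain ⟨J, hJ⟩ := exIdl hc z
    rw [← hF, ← hJ]
    simp [sat, F.bot, J.bot]
  | top =>
    intro z
    obtain ⟨F, hF⟩ := exFil hc z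
    obtain ⟨J, hJ⟩ := exIdl hc z
    rw [← hF, ← hJ]
    simp [sat, F.top, J.top]
  | var n =>
    intro z
    exact ⟨by trivial, (memJ hc z _).symm⟩
  | conj a b iha ihb =>
    intro z
    simp only [sat, iha, ihb, ← hconj]
    exact ⟨by trivial, (memJ hc z _).symm⟩
  | disj a b iha ihb =>
    intro z
    simp only [sat, iha, ihb, ← hdisj]
    exact ⟨(memF hc z _).symm, by trivial⟩
  | box a ih =>
    intro z
    simp only [sat, ih, ← memBox hc]
    exact ⟨by trivial, (memJ hc z _).symm⟩
  | dia a ih =>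
    intro z
    simp only [sat, ih, ← memDia hc]
    exact ⟨(memF hc z _).symm, by trivial⟩

/-- Completeness: a sequent not derivable in `L` fails in some graph-based `L`-frame;
indeed there is a model and a state satisfying `φ`, co-satisfying `ψ`, with `z E z`. -/
theorem stmt9 (φ ψ : Fm) (h : ¬ Deriv φ ψ) :
    ∃ (Z : Type) (F : GFrame Z) (V : ℕ → Set Z × Set Z),
      (∀ n, isConcept F.E (V n)) ∧
      (∃ z : Z, (sat F.E F.Rb F.Rd V φ).1 z ∧ (sat F.E F.Rb F.Rd V ψ).2 z ∧ F.E z z) ∧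
      ¬ validIn F φ ψ := by
  have hc : ¬ Deriv .top .bot := fun h' => h (.cut (dTop φ) (.cut h' (dBot ψ)))
  let z : St := .C (pFil φ fun h' => h (.cut h' (dBot ψ)))
    (pIdl ψ fun h' => h (.cut (dTop φ) h')) (fun a h1 h2 => h (.cut h1 h2))
  have hV : ∀ n, isConcept cE (cV n) := by
    intro n
    constructor
    · ext y
      exact (memJ hc y _).trans ⟨fun h u hu hE => h u hE hu, fun h u hE hu => h u hu hE⟩
    · ext y
      exact (memF hc y _).trans ⟨fun h u hu hE => h u hE hu, fun h u hE hu => h u hu hE⟩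
  have h1 := ((truth hc φ z).1).2 (dId φ)
  have h2 := ((truth hc ψ z).2).2 (dId ψ)
  exact ⟨St, ⟨cE, cB, cD, ⟨z⟩, cRefl hc, compatB hc, compatD hc⟩, cV, hV,
    ⟨z, h1, h2, cRefl hc z⟩, fun hv => hv cV hV z z h1 h2 (cRefl hc z)⟩
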